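/- Let T be a monad on the category of sets and let A be a T-algebra, with compactification Ā (the set of T-morphism types over A) and profinite extensions h̄ : Ā → B for T-morphisms h : A → B into finite T-algebras of the skeleton. Let T̄ together with μ̄ be the profinite monad operations characterized by their defining diagrams. Then there is a unique function mul_Ā : T̄ Ā → Ā such that for every T-morphism h : A → B into a finite T-algebra of the skeleton, h̄ ∘ mul_Ā = (mul_B)‾ ∘ T̄(h̄), where mul_B : T B → B is viewed as a T-morphism from the free algebra on the underlying set of B. Moreover this operation is associative: mul_Ā ∘ μ̄_Ā = mul_Ā ∘ T̄(mul_Ā). -/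

import Mathlib

universe u

structure SetMonad : Type (u + 1) where
  T : Type u → Type u
  map : {X Y : Type u} → (X → Y) → T X → T Y
  unit : {X : Type u} → X → T X
  mult : {X : Type u} → T (T X) → T X
  map_id : ∀ {X : Type u} (w : T X), map id w = w
  map_comp : ∀ {X Y Z : Type u} (g : Y → Z) (f : X → Y) (w : T X),
    map (g ∘ f) w = map g (map f w)
  unit_nat : ∀ {X Y : Type u} (f : X → Y) (x : X), map f (unit x) = unit (f x)
  mult_nat : ∀ {X Y : Type u} (f : X → Y) (w : T (T X)),
    map f (mult w) = mult (map (map f) w)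
  mult_unit : ∀ {X : Type u} (w : T X), mult (unit w) = w
  mult_map_unit : ∀ {X : Type u} (w : T X), mult (map unit w) = w
  mult_assoc : ∀ {X : Type u} (w : T (T (T X))), mult (mult w) = mult (map mult w)

structure SetMonad.Alg (M : SetMonad.{u}) : Type (u + 1) where
  carrier : Type u
  mul : M.T carrier → carrier
  mul_unit : ∀ a, mul (M.unit a) = a
  mul_assoc : ∀ w, mul (M.mult w) = mul (M.map mul w)

namespace SetMonad

variable (M : SetMonad.{u})

/-- `h` is a morphism of Eilenberg–Moore `T`-algebras. -/
def IsHom (A B : M.Alg) (h : A.carrier → B.carrier) : Prop :=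
  ∀ w, h (A.mul w) = B.mul (M.map h w)

/-- The free `T`-algebra on a set. -/
def Free (Sig : Type u) : M.Alg where
  carrier := M.T Sig
  mul := M.mult
  mul_unit := M.mult_unit
  mul_assoc := M.mult_assoc

variable {M}

theorem isHom_comp {A B C : M.Alg} {h : A.carrier → B.carrier}
    {g : B.carrier → C.carrier} (hh : M.IsHom A B h) (hg : M.IsHom B C g) :
    M.IsHom A C (g ∘ h) := by
  intro w
  show g (h (A.mul w)) = C.mul (M.map (g ∘ h) w)
  rw [hh w, hg, M.map_comp]

theorem mapIsHom {Gam Sig : Type u} (f : Gam → Sig) :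
    M.IsHom (M.Free Gam) (M.Free Sig) (M.map f) :=
  fun w => M.mult_nat f w

variable (M)

/-- The finite `T`-algebras of the chosen skeleton: algebra structures on `ULift (Fin n)`. -/
structure FinAlgOn (n : ℕ) : Type u where
  mul : M.T (ULift.{u} (Fin n)) → ULift.{u} (Fin n)
  mul_unit : ∀ a, mul (M.unit a) = a
  mul_assoc : ∀ w, mul (M.mult w) = mul (M.map mul w)

/-- The algebra corresponding to a skeleton algebra. -/
def FinAlgOn.toAlg {M : SetMonad.{u}} {n : ℕ} (B : M.FinAlgOn n) : M.Alg where
  carrier := ULift.{u} (Fin n)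
  mul := B.mul
  mul_unit := B.mul_unit
  mul_assoc := B.mul_assoc

/-- The multiplication of an algebra, viewed as a `T`-morphism from the free algebra on
its underlying set. -/
theorem mulIsHom {n : ℕ} (B : M.FinAlgOn n) :
    M.IsHom (M.Free (ULift.{u} (Fin n))) B.toAlg B.mul :=
  fun w => B.mul_assoc w

/-- A `T`-morphism type over the algebra `A`: a compatible assignment of values to all
`T`-morphisms from `A` into finite `T`-algebras of the skeleton. The set of such types
is the compactification `Ā` of `A`. -/
structure MorphType (A : M.Alg) : Type u where
  app : ∀ (n : ℕ) (B : M.FinAlgOn n) (h : A.carrier → ULift.{u} (Fin n)),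
    M.IsHom A B.toAlg h → ULift.{u} (Fin n)
  compat : ∀ (n m : ℕ) (B : M.FinAlgOn n) (C : M.FinAlgOn m)
    (h : A.carrier → ULift.{u} (Fin n)) (hh : M.IsHom A B.toAlg h)
    (g : ULift.{u} (Fin n) → ULift.{u} (Fin m)) (hg : M.IsHom B.toAlg C.toAlg g),
    app m C (g ∘ h) (isHom_comp hh hg) = g (app n B h hh)

/-- The profinite monad on objects: `T̄ Σ` is the set of morphism types over the free
algebra `T Σ`. -/
def TBar (Sig : Type u) : Type u := M.MorphType (M.Free Sig)


end SetMonad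

/-- Candidate monad operations for the profinite monad `T̄`. -/
structure TBarOps (M : SetMonad.{u}) : Type (u + 1) where
  fmap : {Gam Sig : Type u} → (Gam → Sig) → M.TBar Gam → M.TBar Sig
  unit : {Sig : Type u} → Sig → M.TBar Sig
  mult : {Sig : Type u} → M.TBar (M.TBar Sig) → M.TBar Sig

/-- The defining diagrams of the profinite monad operations. -/
def TBarOps.Char {M : SetMonad.{u}} (o : TBarOps M) : Prop :=
  (∀ (Gam Sig : Type u) (f : Gam → Sig) (n : ℕ) (B : M.FinAlgOn n)
      (h : M.T Sig → ULift.{u} (Fin n)) (hh : M.IsHom (M.Free Sig) B.toAlg h)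
      (τ : M.TBar Gam),
      (o.fmap f τ).app n B h hh
        = τ.app n B (h ∘ M.map f) (SetMonad.isHom_comp (SetMonad.mapIsHom f) hh)) ∧
  (∀ (Sig : Type u) (n : ℕ) (B : M.FinAlgOn n)
      (h : M.T Sig → ULift.{u} (Fin n)) (hh : M.IsHom (M.Free Sig) B.toAlg h)
      (x : Sig),
      (o.unit x).app n B h hh = h (M.unit x)) ∧
  (∀ (Sig : Type u) (n : ℕ) (B : M.FinAlgOn n)
      (h : M.T Sig → ULift.{u} (Fin n)) (hh : M.IsHom (M.Free Sig) B.toAlg h)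
      (τ : M.TBar (M.TBar Sig)),
      (o.mult τ).app n B h hh
        = (o.fmap (fun σ : M.TBar Sig => σ.app n B h hh) τ).app n B B.mul
            (M.mulIsHom B))

namespace SetMonad

theorem MorphType.ext_app {M : SetMonad.{u}} {A : M.Alg} {σ τ : M.MorphType A}
    (H : ∀ n B h hh, σ.app n B h hh = τ.app n B h hh) : σ = τ := by
  cases σ
  cases τ
  congr
  funext n B h hh
  exact H n B h hh

theorem MorphType.app_congr {M : SetMonad.{u}} {A : M.Alg} (τ : M.MorphType A) {n : ℕ}
    {B : M.FinAlgOn n} {h h' : A.carrier → ULift.{u} (Fin n)} (e : h = h')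
    (hh : M.IsHom A B.toAlg h) (hh' : M.IsHom A B.toAlg h') :
    τ.app n B h hh = τ.app n B h' hh' := by
  subst e
  rfl

/-- The `T`-morphism from the free algebra that extends a function into a finite algebra. -/
def FinAlgOn.lift {M : SetMonad.{u}} {n : ℕ} (B : M.FinAlgOn n) {X : Type u}
    (f : X → ULift.{u} (Fin n)) : M.T X → ULift.{u} (Fin n) :=
  B.mul ∘ M.map f

theorem FinAlgOn.isHom_lift {M : SetMonad.{u}} {n : ℕ} (B : M.FinAlgOn n) {X : Type u}
    (f : X → ULift.{u} (Fin n)) : M.IsHom (M.Free X) B.toAlg (B.lift f) :=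
  isHom_comp (mapIsHom f) (M.mulIsHom B)

theorem FinAlgOn.lift_comp {M : SetMonad.{u}} {n : ℕ} (B : M.FinAlgOn n) {X Y : Type u}
    (f : Y → ULift.{u} (Fin n)) (k : X → Y) : B.lift (f ∘ k) = B.lift f ∘ M.map k :=
  funext fun w => congrArg B.mul (M.map_comp f k w)

theorem FinAlgOn.lift_hom_comp {M : SetMonad.{u}} {n m : ℕ} {B : M.FinAlgOn n}
    {C : M.FinAlgOn m} {g : ULift.{u} (Fin n) → ULift.{u} (Fin m)}
    (hg : M.IsHom B.toAlg C.toAlg g) {X : Type u} (f : X → ULift.{u} (Fin n)) :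
    C.lift (g ∘ f) = g ∘ B.lift f :=
  funext fun w => (congrArg C.mul (M.map_comp g f w)).trans (hg (M.map f w)).symm

/-- The multiplication `T̄ Ā → Ā` on the compactification of `A`. -/
def compactMul {M : SetMonad.{u}} (A : M.Alg) (τ : M.TBar (M.MorphType A)) :
    M.MorphType A where
  app n B h hh := MorphType.app τ n B (B.lift fun σ => σ.app n B h hh) (B.isHom_lift _)
  compat n m B C h hh g hg := by
    have e : C.lift (fun σ : M.MorphType A => σ.app m C (g ∘ h) (isHom_comp hh hg))
        = g ∘ B.lift fun σ => σ.app n B h hh := by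
      rw [← FinAlgOn.lift_hom_comp hg]
      exact congrArg C.lift (funext fun σ => σ.compat n m B C h hh g hg)
    exact (MorphType.app_congr τ e _ (isHom_comp (B.isHom_lift _) hg)).trans
      (MorphType.compat τ n m B C _ (B.isHom_lift _) g hg)

end SetMonad

/-- **Multiplication on the compactification.** For every `T`-algebra `A` there is a
unique operation `mul_Ā : T̄ Ā → Ā` such that `h̄ ∘ mul_Ā = (mul_B)‾ ∘ T̄(h̄)` for every
`T`-morphism `h : A → B` into a finite `T`-algebra of the skeleton; moreover this
operation is associative. -/
theorem compactification_multiplication (M : SetMonad.{u}) (o : TBarOps M)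
    (ho : o.Char) (A : M.Alg) :
    ∃ mulbar : M.TBar (M.MorphType A) → M.MorphType A,
      (∀ (n : ℕ) (B : M.FinAlgOn n) (h : A.carrier → ULift.{u} (Fin n))
          (hh : M.IsHom A B.toAlg h) (τ : M.TBar (M.MorphType A)),
        (mulbar τ).app n B h hh
          = (o.fmap (fun σ : M.MorphType A => σ.app n B h hh) τ).app n B B.mul
              (M.mulIsHom B)) ∧
      (∀ mulbar' : M.TBar (M.MorphType A) → M.MorphType A,
        (∀ (n : ℕ) (B : M.FinAlgOn n) (h : A.carrier → ULift.{u} (Fin n))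
            (hh : M.IsHom A B.toAlg h) (τ : M.TBar (M.MorphType A)),
          (mulbar' τ).app n B h hh
            = (o.fmap (fun σ : M.MorphType A => σ.app n B h hh) τ).app n B B.mul
                (M.mulIsHom B)) →
        mulbar' = mulbar) ∧
      (∀ w : M.TBar (M.TBar (M.MorphType A)),
        mulbar (o.mult w) = mulbar (o.fmap mulbar w)) := by
  obtain ⟨hmap, -, hmult⟩ := ho
  have key : ∀ (n : ℕ) (B : M.FinAlgOn n) (h : A.carrier → ULift.{u} (Fin n))
      (hh : M.IsHom A B.toAlg h) (τ : M.TBar (M.MorphType A)),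
      (SetMonad.compactMul A τ).app n B h hh
        = (o.fmap (fun σ : M.MorphType A => σ.app n B h hh) τ).app n B B.mul
            (M.mulIsHom B) :=
    fun n B h hh τ => (hmap _ _ _ n B B.mul (M.mulIsHom B) τ).symm
  refine ⟨SetMonad.compactMul A, key, fun mulbar' H => ?_, fun w => ?_⟩
  · funext τ
    exact SetMonad.MorphType.ext_app fun n B h hh => (H n B h hh τ).trans (key n B h hh τ).symm
  · refine SetMonad.MorphType.ext_app fun n B h hh => ?_
    let ev : M.MorphType A → ULift.{u} (Fin n) := fun σ => σ.app n B h hh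
    refine (hmult _ n B (B.lift ev) (B.isHom_lift ev) w).trans ?_
    refine (hmap _ _ _ n B B.mul (M.mulIsHom B) w).trans ?_
    refine Eq.trans ?_ (hmap _ _ _ n B (B.lift ev) (B.isHom_lift ev) w).symm
    exact SetMonad.MorphType.app_congr w (B.lift_comp ev (SetMonad.compactMul A)) _ _
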